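/- Let (R,m,k) be a regular local ring, P a prime ideal of height d, and x_1,…,x_d ∈ P an R-regular sequence with PR_P = (x_1,…,x_d)R_P. Let (x) = P ∩ q_2 ∩ ⋯ ∩ q_r be a primary decomposition with q_i P_i-primary, let λ ∈ P with λ ∉ P_i for 2 ≤ i ≤ r, and set Ω′ = q_2 ∩ ⋯ ∩ q_r. Fix t ≥ 2 and let i_t : Ω′ → (x) be the injective R-module map μ ↦ λ^t μ. Let F_• be a minimal free resolution of Ω′ and let K_• denote the shifted Koszul complex K_•((x);R)(+1) (with K_j = K_{j+1}(x;R)), a free resolution of the ideal (x). Then every chain map Φ_• : F_• → K_• lifting i_t satisfies Φ_j(F_j) ⊆ m K_j for all j ≥ 0; consequently the mapping cone of Φ_• is a minimal free resolution of (x)/λ^t Ω′. -/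

import Mathlib

open IsLocalRing

universe u

variable (R : Type u) [CommRing R]

/-- Index type for the degree-`n` part of the Koszul complex on `s` generators:
`n`-element subsets of `Fin s` (i.e. strictly increasing `n`-tuples). -/
abbrev KIdx (s n : ℕ) : Type := {T : Finset (Fin s) // T.card = n}

/-- The degree-`n` part of the Koszul complex `K_•(x₁,…,x_s; R)`:
the free `R`-module on `KIdx s n`. -/
abbrev KMod (s n : ℕ) : Type u := KIdx s n →₀ R

/-- The Koszul differential `K_{n+1}(x;R) → K_n(x;R)`,
`e_T ↦ ∑_{j ∈ T} (-1)^{#{i ∈ T : i < j}} x_j e_{T∖{j}}`. -/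
noncomputable def koszulD {s : ℕ} (x : Fin s → R) (n : ℕ) :
    KMod R s (n + 1) →ₗ[R] KMod R s n :=
  Finsupp.lsum R fun T => LinearMap.toSpanSingleton R (KMod R s n)
    (∑ j ∈ T.1.attach,
      ((-1 : R) ^ (T.1.filter (fun i => i < j.1)).card * x j.1) •
        Finsupp.single ⟨T.1.erase j.1, by
          simp [Finset.card_erase_of_mem j.2, T.2]⟩ (1 : R))

/-- A projective resolution `⋯ → F 1 → F 0 → M → 0` of an `R`-module `M`. -/
structure ProjRes (M : Type u) [AddCommGroup M] [Module R M] where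
  F : ℕ → ModuleCat.{u} R
  d : ∀ n, F (n + 1) →ₗ[R] F n
  ε : F 0 →ₗ[R] M
  projective : ∀ n, Module.Projective R (F n)
  surj : Function.Surjective ε
  exact0 : LinearMap.ker ε = LinearMap.range (d 0)
  exact : ∀ n, LinearMap.ker (d n) = LinearMap.range (d (n + 1))

/-- A minimal free resolution of `M` over the local ring `R`: a resolution by
finitely generated free modules all of whose differentials (and the kernel of
whose augmentation) land in `m` times the target. -/
structure MinFreeRes [IsLocalRing R] (M : Type u) [AddCommGroup M] [Module R M]
    extends ProjRes R M where
  free : ∀ n, Module.Free R (F n)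
  fin : ∀ n, Module.Finite R (F n)
  min_aug : LinearMap.ker ε ≤ (maximalIdeal R) • (⊤ : Submodule R (F 0))
  min : ∀ n, LinearMap.range (d n) ≤ (maximalIdeal R) • (⊤ : Submodule R (F n))

/-- `R` is a regular local ring: a Noetherian local ring whose maximal ideal is
generated by `dim R` elements. -/
def IsRegularLocal [IsLocalRing R] : Prop :=
  IsNoetherianRing R ∧ ∃ (n : ℕ) (x : Fin n → R),
    Ideal.span (Set.range x) = maximalIdeal R ∧ ringKrullDim R = n

/-- The ideal `I` has height `d`: `d` is the minimum of the heights of the primes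
containing `I`, the height of a prime `P` being `dim R_P`. -/
def HeightEq (I : Ideal R) (d : ℕ) : Prop :=
  (∃ (P : Ideal R) (h : P.IsPrime), I ≤ P ∧
      ringKrullDim (@Localization.AtPrime R _ P h) = d) ∧
    ∀ (P : Ideal R) (h : P.IsPrime), I ≤ P →
      (d : WithBot ℕ∞) ≤ ringKrullDim (@Localization.AtPrime R _ P h)

/-- The augmentation `K_1(x;R) → (x₁,…,x_d)`, `e_{{i}} ↦ x_i`, exhibiting the
shifted Koszul complex `K_•(x;R)(+1)` as a free resolution of the ideal
`(x₁,…,x_d)` when `x` is a regular sequence. -/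
noncomputable def koszulAug {d : ℕ} (x : Fin d → R) :
    KMod R d 1 →ₗ[R] ↥(Ideal.span (Set.range x)) :=
  Finsupp.lsum R fun T =>
    LinearMap.toSpanSingleton R ↥(Ideal.span (Set.range x))
      ⟨∑ i ∈ T.1, x i, Ideal.sum_mem _ fun i _ => Ideal.subset_span ⟨i, rfl⟩⟩

/-- The modules of the mapping cone of a chain map `Φ` from a resolution `F_•`
to the shifted Koszul complex `K_•(x;R)(+1)` (whose `j`-th module is
`K_{j+1}(x;R)`): `C_0 = K_1` and `C_{j+1} = F_j × K_{j+2}`. -/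
def ConeMod (F : ℕ → ModuleCat.{u} R) (dK : ℕ) : ℕ → Type u
  | 0 => KMod R dK 1
  | (j + 1) => F j × KMod R dK (j + 2)

noncomputable instance (F : ℕ → ModuleCat.{u} R) (dK : ℕ) (j : ℕ) :
    AddCommGroup (ConeMod R F dK j) := by
  cases j with
  | zero => exact inferInstanceAs (AddCommGroup (KMod R dK 1))
  | succ j => exact inferInstanceAs (AddCommGroup (↥(F j) × KMod R dK (j + 2)))

noncomputable instance (F : ℕ → ModuleCat.{u} R) (dK : ℕ) (j : ℕ) :
    Module R (ConeMod R F dK j) := by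
  cases j with
  | zero => exact inferInstanceAs (Module R (KMod R dK 1))
  | succ j => exact inferInstanceAs (Module R (↥(F j) × KMod R dK (j + 2)))

/-- The differentials of the mapping cone of `Φ : F_• → K_•(x;R)(+1)`:
`d(a, b) = (−d_F a, Φ a + d_K b)`. -/
noncomputable def coneD {dK : ℕ} (x : Fin dK → R) (F : ℕ → ModuleCat.{u} R)
    (dF : ∀ n, F (n + 1) →ₗ[R] F n) (Φ : ∀ j, F j →ₗ[R] KMod R dK (j + 1)) :
    ∀ j, ConeMod R F dK (j + 1) →ₗ[R] ConeMod R F dK j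
  | 0 => (Φ 0).comp (LinearMap.fst R (F 0) (KMod R dK 2)) +
      (koszulD R x 1).comp (LinearMap.snd R (F 0) (KMod R dK 2))
  | (j + 1) => LinearMap.prod
      (-((dF j).comp (LinearMap.fst R (F (j + 1)) (KMod R dK (j + 3)))))
      ((Φ (j + 1)).comp (LinearMap.fst R (F (j + 1)) (KMod R dK (j + 3))) +
        (koszulD R x (j + 2)).comp (LinearMap.snd R (F (j + 1)) (KMod R dK (j + 3))))

/-- The data `(C_•, d_•, ε)` is a minimal free resolution of `M`. -/
def IsMinFreeResData [IsLocalRing R] (C : ℕ → Type u) [∀ n, AddCommGroup (C n)]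
    [∀ n, Module R (C n)] (dC : ∀ n, C (n + 1) →ₗ[R] C n)
    (M : Type u) [AddCommGroup M] [Module R M] (ε : C 0 →ₗ[R] M) : Prop :=
  (∀ n, Module.Free R (C n)) ∧ (∀ n, Module.Finite R (C n)) ∧
    Function.Surjective ε ∧
    LinearMap.ker ε = LinearMap.range (dC 0) ∧
    (∀ n, LinearMap.ker (dC n) = LinearMap.range (dC (n + 1))) ∧
    LinearMap.ker ε ≤ (maximalIdeal R) • (⊤ : Submodule R (C 0)) ∧
    ∀ n, LinearMap.range (dC n) ≤ (maximalIdeal R) • (⊤ : Submodule R (C n))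

section Koszul

variable {R} {ι : Type*} [LinearOrder ι]

/-- The sign with which `e_{S}` occurs in the Koszul differential of `e_{S ∪ {j}}`. -/
def koszulSign (R : Type*) [CommRing R] (S : Finset ι) (j : ι) : R :=
  (-1) ^ (S.filter (· < j)).card

lemma koszulSign_mul_self (S : Finset ι) (j : ι) :
    koszulSign R S j * koszulSign R S j = 1 := by
  rw [koszulSign, ← mul_pow]; simp

lemma koszulSign_insert_of_lt {S : Finset ι} {i j : ι} (hij : i < j) (hi : i ∉ S) :
    koszulSign R (insert i S) j = -koszulSign R S j := by
  rw [koszulSign, Finset.filter_insert, if_pos hij, Finset.card_insert_of_notMem (by simp [hi]),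
    pow_succ, koszulSign]
  ring

lemma koszulSign_insert_of_not_lt {S : Finset ι} {i j : ι} (hij : ¬ i < j) :
    koszulSign R (insert i S) j = koszulSign R S j := by
  rw [koszulSign, Finset.filter_insert, if_neg hij, koszulSign]

/-- The total Koszul differential in coordinates, contracting only against the indices in `A`;
the coefficient of `e_S` in `f` is `f S`. -/
def koszulTotal (x : ι → R) (A : Finset ι) : (Finset ι → R) →ₗ[R] (Finset ι → R) where
  toFun f S := ∑ j ∈ A \ S, koszulSign R S j * x j * f (insert j S)
  map_add' f g := by ext S; simp [mul_add, Finset.sum_add_distrib]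
  map_smul' c f := by
    ext S
    simp only [Pi.smul_apply, smul_eq_mul, RingHom.id_apply, Finset.mul_sum]
    exact Finset.sum_congr rfl fun _ _ => by ring

lemma koszulTotal_apply (x : ι → R) (A : Finset ι) (f : Finset ι → R) (S : Finset ι) :
    koszulTotal x A f S = ∑ j ∈ A \ S, koszulSign R S j * x j * f (insert j S) := rfl

lemma koszulTotal_congr (x : ι → R) {A : Finset ι} {f g : Finset ι → R} {S : Finset ι}
    (h : ∀ j ∈ A, j ∉ S → f (insert j S) = g (insert j S)) :
    koszulTotal x A f S = koszulTotal x A g S :=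
  Finset.sum_congr rfl fun j hj => by
    rw [Finset.mem_sdiff] at hj; rw [h j hj.1 hj.2]

lemma koszulTotal_eq_zero (x : ι → R) {A : Finset ι} {f : Finset ι → R} {S : Finset ι}
    (h : ∀ j ∈ A, j ∉ S → f (insert j S) = 0) : koszulTotal x A f S = 0 :=
  Finset.sum_eq_zero fun j hj => by
    rw [Finset.mem_sdiff] at hj; rw [h j hj.1 hj.2, mul_zero]

lemma koszulTotal_insert_of_mem (x : ι → R) {A : Finset ι} {a : ι}
    (f : Finset ι → R) {S : Finset ι} (hS : a ∈ S) :
    koszulTotal x (insert a A) f S = koszulTotal x A f S := by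
  rw [koszulTotal_apply, Finset.insert_sdiff_of_mem _ hS, koszulTotal_apply]

lemma koszulTotal_insert_of_notMem (x : ι → R) {A : Finset ι} {a : ι} (ha : a ∉ A)
    (f : Finset ι → R) {S : Finset ι} (hS : a ∉ S) :
    koszulTotal x (insert a A) f S =
      koszulSign R S a * x a * f (insert a S) + koszulTotal x A f S := by
  rw [koszulTotal_apply, Finset.insert_sdiff_of_notMem _ hS, Finset.sum_insert (by simp [ha]),
    koszulTotal_apply]

lemma koszulTotal_koszulTotal (x : ι → R) (A : Finset ι) (f : Finset ι → R) :
    koszulTotal x A (koszulTotal x A f) = 0 := by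
  induction A using Finset.induction_on_max generalizing f with
  | empty => ext S; simp [koszulTotal_apply]
  | insert a A hA ih =>
    have ha : a ∉ A := fun h => lt_irrefl _ (hA a h)
    ext S
    by_cases hS : a ∈ S
    · rw [koszulTotal_insert_of_mem x _ hS, ← ih f]
      exact koszulTotal_congr x fun j _ _ =>
        koszulTotal_insert_of_mem x f (Finset.mem_insert_of_mem hS)
    · rw [koszulTotal_insert_of_notMem x ha _ hS,
        koszulTotal_insert_of_mem x f (Finset.mem_insert_self a S)]
      have h0 := congrFun (ih f) S
      rw [koszulTotal_apply, Pi.zero_apply] at h0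
      rw [koszulTotal_apply x A f, koszulTotal_apply x A _ S, Finset.mul_sum,
        Finset.sdiff_insert_of_notMem ha, Pi.zero_apply, ← h0, ← Finset.sum_add_distrib]
      refine Finset.sum_congr rfl fun j hj => ?_
      rw [Finset.mem_sdiff] at hj
      have hja := hA j hj.1
      have haj : a ∉ insert j S := by simp [hS, hja.ne']
      rw [koszulTotal_insert_of_notMem x ha f haj, koszulSign_insert_of_lt hja hj.2,
        koszulSign_insert_of_not_lt hja.not_gt, Finset.insert_comm a j S]
      ring

lemma koszulTotal_mem_span (x : ι → R) (A : Finset ι) (f : Finset ι → R) (S : Finset ι) :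
    koszulTotal x A f S ∈ Ideal.span (x '' A) :=
  Ideal.sum_mem _ fun j hj => Ideal.mul_mem_right _ _ <| Ideal.mul_mem_left _ _ <|
    Ideal.subset_span ⟨j, (Finset.mem_sdiff.1 hj).1, rfl⟩

/-- Cycles of the Koszul complex on a regular sequence are boundaries as soon as their
degree zero part vanishes modulo the sequence. -/
theorem exists_koszulTotal_eq (x : ι → R) (A : Finset ι)
    (hx : ∀ a ∈ A, ∀ r, x a * r ∈ Ideal.span (x '' {b ∈ A | b < a}) →
      r ∈ Ideal.span (x '' {b ∈ A | b < a}))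
    (f : Finset ι → R) (hf : koszulTotal x A f = 0)
    (hf0 : ∀ S, Disjoint S A → f S ∈ Ideal.span (x '' A)) :
    ∃ g, koszulTotal x A g = f := by
  induction A using Finset.induction_on_max generalizing f with
  | empty => exact ⟨0, by ext S; simpa [eq_comm] using hf0 S⟩
  | insert a A hA ih =>
    have ha : a ∉ A := fun h => lt_irrefl _ (hA a h)
    have hxa : ∀ r, x a * r ∈ Ideal.span (x '' A) → r ∈ Ideal.span (x '' A) := by
      have hs : {b | b ∈ insert a A ∧ b < a} = (A : Set ι) := by
        ext b
        simp only [Finset.mem_insert, Set.mem_ofPred_eq, Finset.mem_coe]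
        exact ⟨fun h => h.1.resolve_left h.2.ne, fun h => ⟨.inr h, hA b h⟩⟩
      simpa only [hs] using hx a (Finset.mem_insert_self a A)
    replace ih := ih fun c hc => by
      have hs : {b | b ∈ insert a A ∧ b < c} = {b | b ∈ A ∧ b < c} := by
        ext b
        simp only [Finset.mem_insert, Set.mem_ofPred_eq]
        exact ⟨fun h => ⟨h.1.resolve_left (h.2.trans (hA c hc)).ne, h.2⟩,
          fun h => ⟨.inr h.1, h.2⟩⟩
      simpa only [hs] using hx c (Finset.mem_insert_of_mem hc)
    -- the part of `f` involving `a` is a cycle, hence a boundary, for `A`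
    obtain ⟨g₁, hg₁⟩ := ih (fun S => if a ∈ S then f S else 0) (by
      ext S
      by_cases hS : a ∈ S
      · rw [← hf, koszulTotal_insert_of_mem x f hS]
        exact koszulTotal_congr x fun j _ _ => if_pos (Finset.mem_insert_of_mem hS)
      · refine koszulTotal_eq_zero x fun j hj _ => if_neg ?_
        simp [hS, (hA j hj).ne']) (by
      intro S hSA
      split_ifs with hS
      · have h := congrFun hf (S.erase a)
        rw [koszulTotal_insert_of_notMem x ha f (Finset.notMem_erase a S),
          Finset.insert_erase hS, Pi.zero_apply] at h
        apply hxa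
        have h' : x a * f S =
            -(koszulSign R (S.erase a) a * koszulTotal x A f (S.erase a)) := by
          linear_combination koszulSign R (S.erase a) a * h -
            x a * f S * koszulSign_mul_self (R := R) (S.erase a) a
        rw [h']
        exact neg_mem (Ideal.mul_mem_left _ _ (koszulTotal_mem_span x A f _))
      · exact zero_mem _)
    have hv : ∀ S, ∃ v, Disjoint S (insert a A) →
        f S - koszulSign R S a * x a * v ∈ Ideal.span (x '' A) := by
      intro S
      by_cases hS : Disjoint S (insert a A)
      · have h := hf0 S hS
        rw [Finset.coe_insert, Set.image_insert_eq, Ideal.mem_span_insert] at h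
        obtain ⟨v, z, hz, h⟩ := h
        refine ⟨koszulSign R S a * v, fun _ => ?_⟩
        convert hz using 1
        linear_combination h - v * x a * koszulSign_mul_self (R := R) S a
      · exact ⟨0, fun h => absurd h hS⟩
    choose v hv using hv
    set g₂ : Finset ι → R := fun S => if Disjoint S A then v (S.erase a) else g₁ S with hg₂
    have hg₂₁ : koszulTotal x A g₂ = fun S => if a ∈ S then f S else 0 := by
      rw [← hg₁]
      ext S
      refine koszulTotal_congr x fun j hj _ => if_neg fun h => ?_
      exact Finset.disjoint_left.1 h (Finset.mem_insert_self j S) hj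
    set f₂ := f - koszulTotal x (insert a A) g₂ with hf₂
    have hf₂a : ∀ S, a ∈ S → f₂ S = 0 := fun S hS => by
      rw [hf₂, Pi.sub_apply, koszulTotal_insert_of_mem x _ hS, hg₂₁]; simp [hS]
    have hf₂c : koszulTotal x (insert a A) f₂ = 0 := by
      rw [hf₂, map_sub, hf, koszulTotal_koszulTotal, sub_zero]
    obtain ⟨g₃, hg₃⟩ := ih f₂ (by
      ext S
      have h := congrFun hf₂c S
      by_cases hS : a ∈ S
      · rwa [koszulTotal_insert_of_mem x _ hS] at h
      · rwa [koszulTotal_insert_of_notMem x ha _ hS, hf₂a _ (Finset.mem_insert_self a S),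
          mul_zero, zero_add] at h) (by
      intro S hSA
      by_cases hS : a ∈ S
      · rw [hf₂a S hS]; exact zero_mem _
      · have h := hv S (by simp [hS, hSA])
        rw [hf₂, Pi.sub_apply, koszulTotal_insert_of_notMem x ha _ hS, hg₂₁]
        simpa [hg₂, hS, hSA, ha] using h)
    refine ⟨g₂ + fun S => if a ∈ S then 0 else g₃ S, ?_⟩
    rw [map_add, add_comm, ← eq_sub_iff_add_eq, ← hf₂]
    ext S
    by_cases hS : a ∈ S
    · rw [hf₂a S hS, koszulTotal_insert_of_mem x _ hS]
      exact koszulTotal_eq_zero x fun j _ _ => if_pos (Finset.mem_insert_of_mem hS)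
    · rw [koszulTotal_insert_of_notMem x ha _ hS, if_pos (Finset.mem_insert_self a S), mul_zero,
        zero_add, ← hg₃]
      refine koszulTotal_congr x fun j hj _ => if_neg ?_
      simp [hS, (hA j hj).ne']

end Koszul

section KoszulGraded

variable {R} {s : ℕ}

/-- Extension by zero of a degree `n` Koszul chain to all subsets. -/
def koszulExt (n : ℕ) : KMod R s n →ₗ[R] (Finset (Fin s) → R) where
  toFun w S := if h : S.card = n then w ⟨S, h⟩ else 0
  map_add' v w := by ext S; by_cases h : S.card = n <;> simp [h]
  map_smul' c w := by ext S; by_cases h : S.card = n <;> simp [h]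

lemma koszulExt_of_card {n : ℕ} (w : KMod R s n) {S : Finset (Fin s)} (h : S.card = n) :
    koszulExt n w S = w ⟨S, h⟩ := dif_pos h

lemma koszulExt_of_card_ne {n : ℕ} (w : KMod R s n) {S : Finset (Fin s)} (h : S.card ≠ n) :
    koszulExt n w S = 0 := dif_neg h

lemma koszulExt_single {n : ℕ} (T : KIdx s n) (r : R) (S : Finset (Fin s)) :
    koszulExt n (Finsupp.single T r) S = if T.1 = S then r else 0 := by
  by_cases h : S.card = n
  · rw [koszulExt_of_card _ h, Finsupp.single_apply]
    simp only [Subtype.ext_iff]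
  · rw [koszulExt_of_card_ne _ h, if_neg]
    rintro rfl
    exact h T.2

lemma koszulD_single (x : Fin s → R) (n : ℕ) (T : KIdx s (n + 1)) (r : R) :
    koszulD R x n (Finsupp.single T r) = r • ∑ j ∈ T.1.attach,
      ((-1 : R) ^ (T.1.filter (fun i => i < j.1)).card * x j.1) •
        Finsupp.single ⟨T.1.erase j.1, by
          simp [Finset.card_erase_of_mem j.2, T.2]⟩ (1 : R) := by
  simp [koszulD]

lemma koszulExt_koszulD (x : Fin s → R) (n : ℕ) (w : KMod R s (n + 1)) :
    koszulExt n (koszulD R x n w) = koszulTotal x Finset.univ (koszulExt (n + 1) w) := by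
  refine LinearMap.congr_fun (f := koszulExt n ∘ₗ koszulD R x n)
    (g := koszulTotal x Finset.univ ∘ₗ koszulExt (n + 1))
    (Finsupp.lhom_ext' fun T => LinearMap.ext_ring ?_) w
  ext S
  simp only [LinearMap.comp_apply, Finsupp.lsingle_apply, koszulD_single, one_smul, map_sum,
    map_smul, Finset.sum_apply, Pi.smul_apply, koszulExt_single, koszulTotal_apply, smul_eq_mul]
  rw [Finset.sum_attach T.1 fun j => (-1 : R) ^ (T.1.filter (fun i => i < j)).card * x j *
    if T.1.erase j = S then 1 else 0]
  refine Finset.sum_congr_of_eq_on_inter (fun j _ hj' => ?_) (fun j _ hj' => ?_)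
    (fun j hj hj' => ?_)
  · rw [if_neg, mul_zero]
    rintro rfl
    simp at hj'
  · rw [if_neg, mul_zero]
    intro h
    exact hj' (h ▸ Finset.mem_insert_self j S)
  · have hjS : j ∉ S := by simpa using hj'
    by_cases h : T.1 = insert j S
    · rw [h, Finset.erase_insert hjS, if_pos rfl, if_pos rfl, Finset.filter_insert,
        if_neg (lt_irrefl j), koszulSign]
    · rw [if_neg h, if_neg, mul_zero, mul_zero]
      rintro rfl
      exact h (Finset.insert_erase hj).symm

lemma koszulD_apply (x : Fin s → R) (n : ℕ) (w : KMod R s (n + 1)) (T : KIdx s n) :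
    koszulD R x n w T = koszulTotal x Finset.univ (koszulExt (n + 1) w) T.1 := by
  rw [← koszulExt_koszulD, koszulExt_of_card _ T.2]

lemma koszulD_koszulD (x : Fin s → R) (n : ℕ) (w : KMod R s (n + 2)) :
    koszulD R x n (koszulD R x (n + 1) w) = 0 := by
  ext T
  rw [koszulD_apply, koszulExt_koszulD, koszulTotal_koszulTotal]
  rfl

lemma mem_span_of_isWeaklyRegular_ofFn {x : Fin s → R}
    (hx : RingTheory.Sequence.IsWeaklyRegular R (List.ofFn x)) (a : Fin s) (r : R)
    (h : x a * r ∈ Ideal.span (x '' {b | b < a})) : r ∈ Ideal.span (x '' {b | b < a}) := by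
  have hs : Ideal.ofList ((List.ofFn x).take a) • (⊤ : Submodule R R) =
      Ideal.span (x '' {b | b < a}) := by
    rw [smul_eq_mul, Ideal.mul_top]
    refine congrArg Ideal.span (Set.ext fun y => ?_)
    simp only [List.mem_take_iff_getElem, List.getElem_ofFn, Set.mem_image, Set.mem_ofPred_eq]
    constructor
    · rintro ⟨i, hi, rfl⟩
      rw [List.length_ofFn, lt_min_iff] at hi
      exact ⟨⟨i, hi.2⟩, hi.1, rfl⟩
    · rintro ⟨b, hb, rfl⟩
      exact ⟨b, by simpa using hb, rfl⟩
  have := hx.regular_mod_prev a (by simp)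
  rw [isSMulRegular_quotient_iff_mem_of_smul_mem, hs] at this
  exact this r (by simpa using h)

lemma ker_koszulD (x : Fin s → R)
    (hx : RingTheory.Sequence.IsWeaklyRegular R (List.ofFn x)) (n : ℕ) :
    LinearMap.ker (koszulD R x n) = LinearMap.range (koszulD R x (n + 1)) := by
  refine le_antisymm (fun w hw => ?_) ?_
  · obtain ⟨g, hg⟩ := exists_koszulTotal_eq x Finset.univ
      (fun a _ r h => by
        simp only [Finset.mem_univ, true_and] at h ⊢
        exact mem_span_of_isWeaklyRegular_ofFn hx a r h)
      (koszulExt (n + 1) w)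
      (by rw [← koszulExt_koszulD, LinearMap.mem_ker.1 hw, map_zero])
      (fun S hS => by
        have hS' : S = ∅ := by rwa [← Finset.top_eq_univ, disjoint_top] at hS
        rw [koszulExt_of_card_ne _ (by simp [hS'])]
        exact zero_mem _)
    refine ⟨Finsupp.equivFunOnFinite.symm fun T => g T.1, ?_⟩
    ext T
    rw [koszulD_apply, ← koszulExt_of_card w T.2, ← hg]
    refine koszulTotal_congr x fun j _ hj => ?_
    rw [koszulExt_of_card _ (by rw [Finset.card_insert_of_notMem hj, T.2])]
    rfl
  · rintro _ ⟨w, rfl⟩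
    exact koszulD_koszulD x n w

lemma koszulAug_single (x : Fin s → R) (T : KIdx s 1) (r : R) :
    (koszulAug R x (Finsupp.single T r) : R) = r * ∑ i ∈ T.1, x i := by
  simp [koszulAug]

lemma koszulD_zero_eq_single (x : Fin s → R) (w : KMod R s 1) :
    koszulD R x 0 w = Finsupp.single ⟨∅, rfl⟩ (koszulAug R x w : R) := by
  refine LinearMap.congr_fun (f := koszulD R x 0) (g := Finsupp.lsingle ⟨∅, rfl⟩ ∘ₗ
    (Ideal.span (Set.range x)).subtype ∘ₗ koszulAug R x)
    (Finsupp.lhom_ext' fun T => LinearMap.ext_ring ?_) w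
  obtain ⟨T, hT⟩ := T
  obtain ⟨i, rfl⟩ := Finset.card_eq_one.1 hT
  ext ⟨S, hS⟩
  obtain rfl := Finset.card_eq_zero.1 hS
  simp [koszulD_apply, koszulTotal_apply, koszulExt_single, koszulAug_single, koszulSign]

lemma ker_koszulAug (x : Fin s → R)
    (hx : RingTheory.Sequence.IsWeaklyRegular R (List.ofFn x)) :
    LinearMap.ker (koszulAug R x) = LinearMap.range (koszulD R x 1) := by
  rw [← ker_koszulD x hx]
  ext w
  simp [koszulD_zero_eq_single]

lemma koszulAug_surjective (x : Fin s → R) : Function.Surjective (koszulAug R x) := by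
  have h : Ideal.span (Set.range x) ≤
      (LinearMap.range (koszulAug R x)).map (Ideal.span (Set.range x)).subtype := by
    rw [Ideal.span_le]
    rintro _ ⟨i, rfl⟩
    exact ⟨_, ⟨Finsupp.single ⟨{i}, rfl⟩ 1, rfl⟩, by simp [koszulAug_single]⟩
  intro y
  obtain ⟨_, ⟨w, rfl⟩, hw⟩ := h y.2
  exact ⟨w, Subtype.ext hw⟩

lemma range_koszulD_le (x : Fin s → R) {I : Ideal R} (hx : ∀ i, x i ∈ I) (n : ℕ) :
    LinearMap.range (koszulD R x n) ≤ I • (⊤ : Submodule R (KMod R s n)) := by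
  rintro _ ⟨w, rfl⟩
  induction w using Finsupp.induction_linear with
  | zero => simp
  | add v w hv hw => rw [map_add]; exact add_mem hv hw
  | single T r =>
    rw [koszulD_single]
    exact Submodule.smul_mem _ _ <| Submodule.sum_mem _ fun j _ =>
      Submodule.smul_mem_smul (I.mul_mem_left _ (hx j)) trivial

end KoszulGraded

section Lifting

variable {R}

lemma Module.Projective.exists_comp_eq_of_range_le {P M N : Type*} [AddCommGroup P] [Module R P]
    [Module.Projective R P] [AddCommGroup M] [Module R M] [AddCommGroup N] [Module R N]
    (g : M →ₗ[R] N) (f : P →ₗ[R] N) (h : LinearMap.range f ≤ LinearMap.range g) :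
    ∃ l : P →ₗ[R] M, g ∘ₗ l = f := by
  obtain ⟨l, hl⟩ := Module.projective_lifting_property g.rangeRestrict
    (f.codRestrict (LinearMap.range g) fun p => h ⟨p, rfl⟩) g.surjective_rangeRestrict
  exact ⟨l, LinearMap.ext fun p => congrArg Subtype.val (LinearMap.congr_fun hl p)⟩

lemma ProjRes.d_d {M : Type u} [AddCommGroup M] [Module R M] (F : ProjRes R M) (n : ℕ)
    (w : F.F (n + 2)) : F.d n (F.d (n + 1) w) = 0 := by
  have h : F.d (n + 1) w ∈ LinearMap.ker (F.d n) := F.exact n ▸ ⟨w, rfl⟩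
  exact h

lemma ProjRes.ε_d {M : Type u} [AddCommGroup M] [Module R M] (F : ProjRes R M)
    (w : F.F 1) : F.ε (F.d 0 w) = 0 := by
  have h : F.d 0 w ∈ LinearMap.ker F.ε := F.exact0 ▸ ⟨w, rfl⟩
  exact h

lemma LinearMap.apply_mem_smul_top {M N : Type*} [AddCommGroup M] [Module R M] [AddCommGroup N]
    [Module R N] (f : M →ₗ[R] N) {I : Ideal R} {m : M} (hm : m ∈ I • (⊤ : Submodule R M)) :
    f m ∈ I • (⊤ : Submodule R N) :=
  (smul_mono_right I le_top : I • (⊤ : Submodule R M).map f ≤ _) (Submodule.map_smul'' I ⊤ f ▸ Submodule.mem_map_of_mem hm)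

/-- A chain map from a projective resolution to a resolution, both with differentials in `I`,
that lifts `c • f` with `c ∈ I`, has image in `I`: it is homotopic to `c` times a lift of `f`. -/
theorem ProjRes.range_le_smul_top_of_lifts_smul {M N : Type u} [AddCommGroup M] [Module R M]
    [AddCommGroup N] [Module R N] (F : ProjRes R M) {I : Ideal R}
    (hF : ∀ n, LinearMap.range (F.d n) ≤ I • ⊤)
    {K : ℕ → Type*} [∀ n, AddCommGroup (K n)] [∀ n, Module R (K n)]
    (dK : ∀ n, K (n + 1) →ₗ[R] K n) (εK : K 0 →ₗ[R] N) (hεK : Function.Surjective εK)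
    (hK0 : LinearMap.ker εK = LinearMap.range (dK 0))
    (hK : ∀ n, LinearMap.ker (dK n) = LinearMap.range (dK (n + 1)))
    (hdK : ∀ n, LinearMap.range (dK n) ≤ I • ⊤)
    (f : M →ₗ[R] N) {c : R} (hc : c ∈ I) (Φ : ∀ n, F.F n →ₗ[R] K n)
    (hΦ : ∀ n, dK n ∘ₗ Φ (n + 1) = Φ n ∘ₗ F.d n) (hΦ0 : ∀ w, εK (Φ 0 w) = c • f (F.ε w))
    (n : ℕ) : LinearMap.range (Φ n) ≤ I • ⊤ := by
  have := F.projective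
  suffices h : LinearMap.range (Φ n) ≤ I • ⊤ ∧ ∃ (φ : F.F n →ₗ[R] K n)
      (h : F.F n →ₗ[R] K (n + 1)), (∀ w, φ (F.d n w) ∈ LinearMap.range (dK n)) ∧
        ∀ w, Φ n (F.d n w) = c • φ (F.d n w) + dK n (h (F.d n w)) from h.1
  induction n with
  | zero =>
    obtain ⟨φ, hφ⟩ := Module.projective_lifting_property εK (f ∘ₗ F.ε) hεK
    replace hφ w : εK (φ w) = f (F.ε w) := LinearMap.congr_fun hφ w
    obtain ⟨h, hh⟩ := Module.Projective.exists_comp_eq_of_range_le (dK 0) (Φ 0 - c • φ) <| by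
      rw [← hK0]
      rintro _ ⟨w, rfl⟩
      simp [hΦ0, hφ]
    replace hh w : Φ 0 w = c • φ w + dK 0 (h w) := by
      have := LinearMap.congr_fun hh w
      simp only [LinearMap.comp_apply, LinearMap.sub_apply, LinearMap.smul_apply] at this
      rw [this]; abel
    refine ⟨?_, φ, h, fun w => ?_, fun w => hh _⟩
    · rintro _ ⟨w, rfl⟩
      rw [hh]
      exact add_mem (Submodule.smul_mem_smul hc trivial) (hdK 0 ⟨_, rfl⟩)
    · rw [← hK0, LinearMap.mem_ker, hφ, F.ε_d, map_zero]
  | succ n ih =>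
    obtain ⟨-, φ, h, hφ, hh⟩ := ih
    replace hΦ w : dK n (Φ (n + 1) w) = Φ n (F.d n w) := LinearMap.congr_fun (hΦ n) w
    obtain ⟨ψ, hψ⟩ := Module.Projective.exists_comp_eq_of_range_le (dK n) (φ ∘ₗ F.d n) <| by
      rintro _ ⟨w, rfl⟩
      exact hφ w
    replace hψ w : dK n (ψ w) = φ (F.d n w) := LinearMap.congr_fun hψ w
    obtain ⟨k, hk⟩ := Module.Projective.exists_comp_eq_of_range_le (dK (n + 1))
        (Φ (n + 1) - c • ψ - h ∘ₗ F.d n) <| by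
      rw [← hK]
      rintro _ ⟨w, rfl⟩
      simp [hΦ, hψ, hh]
    replace hk w : Φ (n + 1) w = c • ψ w + dK (n + 1) (k w) + h (F.d n w) := by
      have := LinearMap.congr_fun hk w
      simp only [LinearMap.comp_apply, LinearMap.sub_apply, LinearMap.smul_apply] at this
      rw [this]; abel
    refine ⟨?_, ψ, k, fun w => ?_, fun w => ?_⟩
    · rintro _ ⟨w, rfl⟩
      rw [hk]
      exact add_mem (add_mem (Submodule.smul_mem_smul hc trivial) (hdK (n + 1) ⟨_, rfl⟩))
        (h.apply_mem_smul_top (hF n ⟨w, rfl⟩))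
    · rw [← hK, LinearMap.mem_ker, hψ, F.d_d, map_zero]
    · rw [hk, F.d_d, map_zero, add_zero]

end Lifting

section Cone

variable {R} {s : ℕ}

lemma Submodule.mk_mem_smul_top {M N : Type*} [AddCommGroup M] [Module R M] [AddCommGroup N]
    [Module R N] {I : Ideal R} {m : M} {n : N} (hm : m ∈ I • (⊤ : Submodule R M))
    (hn : n ∈ I • (⊤ : Submodule R N)) : (m, n) ∈ I • (⊤ : Submodule R (M × N)) := by
  have := add_mem ((LinearMap.inl R M N).apply_mem_smul_top hm)
    ((LinearMap.inr R M N).apply_mem_smul_top hn)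
  simpa using this

/-- The mapping cone of a chain map from a minimal free resolution to the Koszul complex on a
regular sequence is a minimal free resolution of the cokernel, provided the chain map vanishes
modulo the maximal ideal. -/
theorem isMinFreeResData_cone [IsLocalRing R] {x : Fin s → R}
    (hx : RingTheory.Sequence.IsWeaklyRegular R (List.ofFn x))
    (hxm : ∀ i, x i ∈ maximalIdeal R)
    {M : Type u} [AddCommGroup M] [Module R M] (F : MinFreeRes R M)
    (f : M →ₗ[R] ↥(Ideal.span (Set.range x))) (hf : Function.Injective f)
    (Φ : ∀ j, F.F j →ₗ[R] KMod R s (j + 1))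
    (hcomm : ∀ j, (koszulD R x (j + 1)).comp (Φ (j + 1)) = (Φ j).comp (F.d j))
    (haug : ∀ w : F.F 0, koszulAug R x (Φ 0 w) = f (F.ε w))
    (hΦ : ∀ j, LinearMap.range (Φ j) ≤ maximalIdeal R • ⊤) :
    IsMinFreeResData R (ConeMod R F.F s) (coneD R x F.F F.d Φ)
      (↥(Ideal.span (Set.range x)) ⧸ LinearMap.range f)
      ((LinearMap.range f).mkQ.comp (koszulAug R x)) := by
  have := F.free
  have := F.fin
  have hcomm' j w : koszulD R x (j + 1) (Φ (j + 1) w) = Φ j (F.d j w) :=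
    LinearMap.congr_fun (hcomm j) w
  have hmin j : LinearMap.range (coneD R x F.F F.d Φ j) ≤ maximalIdeal R • ⊤ := by
    cases j with
    | zero =>
      rintro _ ⟨⟨a, b⟩, rfl⟩
      exact add_mem (hΦ 0 ⟨a, rfl⟩) (range_koszulD_le x hxm 1 ⟨b, rfl⟩)
    | succ j =>
      rintro _ ⟨⟨a, b⟩, rfl⟩
      exact Submodule.mk_mem_smul_top (neg_mem (F.min j ⟨a, rfl⟩))
        (add_mem (hΦ (j + 1) ⟨a, rfl⟩) (range_koszulD_le x hxm (j + 2) ⟨b, rfl⟩))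
  have hexact0 : LinearMap.ker ((LinearMap.range f).mkQ.comp (koszulAug R x)) =
      LinearMap.range (coneD R x F.F F.d Φ 0) := by
    refine le_antisymm (fun (k : KMod R s 1) hk => ?_) ?_
    · have hk' : koszulAug R x k ∈ LinearMap.range f := by
        simpa only [LinearMap.mem_ker, LinearMap.comp_apply, Submodule.mkQ_apply,
          Submodule.Quotient.mk_eq_zero] using hk
      obtain ⟨μ, hμ⟩ := hk'
      obtain ⟨w, rfl⟩ := F.surj μ
      have h : k - Φ 0 w ∈ LinearMap.ker (koszulAug R x) := by
        rw [LinearMap.mem_ker, map_sub, haug, hμ, sub_self]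
      rw [ker_koszulAug x hx] at h
      obtain ⟨b, hb⟩ := h
      exact ⟨(w, b), show Φ 0 w + koszulD R x 1 b = k by rw [hb]; abel⟩
    · rintro _ ⟨⟨a, b⟩, rfl⟩
      change (LinearMap.range f).mkQ (koszulAug R x (Φ 0 a + koszulD R x 1 b)) = 0
      have hb : koszulD R x 1 b ∈ LinearMap.ker (koszulAug R x) :=
        ker_koszulAug x hx ▸ ⟨b, rfl⟩
      rw [map_add, LinearMap.mem_ker.1 hb, add_zero, haug]
      simp
  refine ⟨fun j => ?_, fun j => ?_, ?_, hexact0, fun j => ?_, hexact0 ▸ hmin 0, hmin⟩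
  · cases j with
    | zero => exact inferInstanceAs (Module.Free R (KMod R s 1))
    | succ j => exact inferInstanceAs (Module.Free R (F.F j × KMod R s (j + 2)))
  · cases j with
    | zero => exact inferInstanceAs (Module.Finite R (KMod R s 1))
    | succ j => exact inferInstanceAs (Module.Finite R (F.F j × KMod R s (j + 2)))
  · exact (Submodule.mkQ_surjective _).comp (koszulAug_surjective x)
  · -- correct `(a, b)` by a preimage `w` of `a`; the error is a Koszul cycle
    have lift {j : ℕ} {a : F.F j} {b : KMod R s (j + 2)}
        (ha : ∃ w, F.d j w = a) (hab : Φ j a + koszulD R x (j + 1) b = 0) :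
        ((a, b) : ConeMod R F.F s (j + 1)) ∈ LinearMap.range (coneD R x F.F F.d Φ (j + 1)) := by
      obtain ⟨w, rfl⟩ := ha
      have h : b + Φ (j + 1) w ∈ LinearMap.ker (koszulD R x (j + 1)) := by
        rw [LinearMap.mem_ker, map_add, hcomm', add_comm (koszulD R x (j + 1) b), hab]
      rw [ker_koszulD x hx] at h
      obtain ⟨c, hc⟩ := h
      refine ⟨(-w, c), ?_⟩
      change (-F.d j (-w), Φ (j + 1) (-w) + koszulD R x (j + 2) c) = (F.d j w, b)
      rw [hc, map_neg, map_neg, neg_neg]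
      congr 1
      abel
    cases j with
    | zero =>
      refine le_antisymm ?_ ?_
      · rintro ⟨a, b⟩ (hab : Φ 0 a + koszulD R x 1 b = 0)
        refine lift ?_ hab
        have hb : koszulD R x 1 b ∈ LinearMap.ker (koszulAug R x) :=
          ker_koszulAug x hx ▸ ⟨b, rfl⟩
        have h := congrArg (koszulAug R x) hab
        rw [map_add, LinearMap.mem_ker.1 hb, add_zero, haug, map_zero] at h
        have ha : a ∈ LinearMap.ker F.ε := hf (h.trans (map_zero f).symm)
        rwa [F.exact0] at ha
      · rintro _ ⟨⟨a, b⟩, rfl⟩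
        change Φ 0 (-F.d 0 a) + koszulD R x 1 (Φ 1 a + koszulD R x 2 b) = 0
        rw [map_neg, map_add, koszulD_koszulD, hcomm']
        abel
    | succ j =>
      refine le_antisymm ?_ ?_
      · rintro ⟨a, b⟩ hab
        have hab' : (-F.d j a, Φ (j + 1) a + koszulD R x (j + 2) b) = 0 := hab
        rw [Prod.mk_eq_zero, neg_eq_zero] at hab'
        refine lift ?_ hab'.2
        have ha : a ∈ LinearMap.ker (F.d j) := hab'.1
        rwa [F.exact] at ha
      · rintro _ ⟨⟨a, b⟩, rfl⟩
        change (-F.d j (-F.d (j + 1) a), Φ (j + 1) (-F.d (j + 1) a) +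
          koszulD R x (j + 2) (Φ (j + 2) a + koszulD R x (j + 3) b)) = 0
        rw [map_neg, map_neg, map_add, koszulD_koszulD, hcomm', F.d_d, Prod.mk_eq_zero]
        constructor
        · simp
        · abel

end Cone

/-- Let `(R,m,k)` be a regular local ring, `P` a prime ideal
of height `d`, and `x₁,…,x_d ∈ P` an `R`-regular sequence with
`P·R_P = (x)·R_P`.  Let `(x) = P ∩ q₂ ∩ ⋯ ∩ q_r` be a primary decomposition
with `q_i` `P_i`-primary, let `λ ∈ P` with `λ ∉ P_i` for `2 ≤ i ≤ r`, and set
`Ω′ = q₂ ∩ ⋯ ∩ q_r`.  Fix `t ≥ 2` and let `i_t : Ω′ → (x)` be the injective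
`R`-module map `μ ↦ λ^t μ`.  Let `F_•` be a minimal free resolution of `Ω′` and
let `K_•` denote the shifted Koszul complex `K_•(x;R)(+1)` (with
`K_j = K_{j+1}(x;R)`), a free resolution of the ideal `(x)`.  Then every chain
map `Φ_• : F_• → K_•` lifting `i_t` satisfies `Φ_j(F_j) ⊆ m·K_j` for all
`j ≥ 0`; consequently the mapping cone of `Φ_•` is a minimal free resolution of
`(x)/λ^t Ω′ = coker i_t`. -/
theorem statement14
    (R : Type u) [CommRing R] [IsLocalRing R] (hreg : IsRegularLocal R)
    (P : Ideal R) (hP : P.IsPrime) (d : ℕ) (hht : HeightEq R P d)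
    (x : Fin d → R) (hxP : ∀ j, x j ∈ P)
    (hxreg : RingTheory.Sequence.IsRegular R (List.ofFn x))
    (hloc : Ideal.map (algebraMap R (@Localization.AtPrime R _ P hP)) P =
      Ideal.map (algebraMap R (@Localization.AtPrime R _ P hP))
        (Ideal.span (Set.range x)))
    {r : ℕ} (q : Fin r → Ideal R) (Pi : Fin r → Ideal R)
    (hprimary : ∀ i, (q i).IsPrimary ∧ (q i).radical = Pi i)
    (hdecomp : Ideal.span (Set.range x) = P ⊓ ⨅ i, q i)
    (lam : R) (hlamP : lam ∈ P) (hlam : ∀ i, lam ∉ Pi i)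
    (t : ℕ) (ht : 2 ≤ t)
    -- the injection `i_t : Ω′ → (x)`, `μ ↦ λ^t μ`
    (it : ↥(⨅ i, q i : Ideal R) →ₗ[R] ↥(Ideal.span (Set.range x)))
    (hit : ∀ μ : ↥(⨅ i, q i : Ideal R), (it μ : R) = lam ^ t * (μ : R))
    (hitinj : Function.Injective it)
    -- a minimal free resolution `F_•` of `Ω′`
    (F : MinFreeRes R ↥(⨅ i, q i : Ideal R))
    -- a chain map `Φ_• : F_• → K_•(x;R)(+1)` lifting `i_t`
    (Φ : ∀ j, F.F j →ₗ[R] KMod R d (j + 1))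
    (hcomm : ∀ j, (koszulD R x (j + 1)).comp (Φ (j + 1)) = (Φ j).comp (F.d j))
    (haug : ∀ w : F.F 0, koszulAug R x (Φ 0 w) = it (F.ε w)) :
    (∀ j, LinearMap.range (Φ j) ≤
        (maximalIdeal R) • (⊤ : Submodule R (KMod R d (j + 1)))) ∧
      IsMinFreeResData R (ConeMod R F.F d) (coneD R x F.F F.d Φ)
        (↥(Ideal.span (Set.range x)) ⧸ LinearMap.range it)
        ((LinearMap.range it).mkQ.comp (koszulAug R x)) := by
  have hPm : P ≤ maximalIdeal R := le_maximalIdeal hP.ne_top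
  have hxm i : x i ∈ maximalIdeal R := hPm (hxP i)
  have hreg' := hxreg.toIsWeaklyRegular
  let f : ↥(⨅ i, q i : Ideal R) →ₗ[R] ↥(Ideal.span (Set.range x)) :=
    (LinearMap.mulLeft R lam).restrict fun μ hμ => by
      rw [hdecomp]
      exact ⟨P.mul_mem_right μ hlamP, Ideal.mul_mem_left _ lam hμ⟩
  have hΦ := F.range_le_smul_top_of_lifts_smul F.min (fun j => koszulD R x (j + 1))
    (koszulAug R x) (koszulAug_surjective x) (ker_koszulAug x hreg')
    (fun j => ker_koszulD x hreg' (j + 1)) (fun j => range_koszulD_le x hxm (j + 1)) f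
    (Ideal.pow_mem_of_mem _ (hPm hlamP) (t - 1) (by lia)) Φ hcomm fun w => by
      rw [haug]
      ext
      obtain ⟨t, rfl⟩ : ∃ n, t = n + 1 := ⟨t - 1, by lia⟩
      simp [hit, f, pow_succ, mul_assoc]
  exact ⟨hΦ, isMinFreeResData_cone hreg' hxm F it hitinj Φ hcomm haug hΦ⟩
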